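/- Let R be a commutative ring, m an odd positive integer, T an m×m skew-symmetric matrix over R with zeros on the diagonal, z₁,z₂,z₃ ∈ R, and c_{i,j,l} ∈ R with T_{j,i} = Σ_{l=1}^{3} c_{i,j,l} z_l for all i,j. Then for all i, j, k ∈ {1,…,m} with k ∉ {i,j} (i = j being allowed): δ_{i,j}·d^k_{1,2} + Σ_{r=1, r≠k}^{m} T_{r,j} d^{k,i,r}_{1,2} + Σ_{r=1}^{m} σ_{k,i,r} pf_{k̂,î,r̂}(T)·(c_{r,k,1} c_{j,k,2} − c_{j,k,1} c_{r,k,2}) = 0, where δ_{i,j} is the Kronecker delta. -/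

import Mathlib

open Finset

/-- The unit step (Heaviside) function on the integers. -/
def theta (x : ℤ) : ℕ := if 0 < x then 1 else 0

/-- `σ_{i,j,r}` for (1-based) labels `i j r`. -/
def sigma3 (i j r : ℕ) : ℤ :=
  if i ≠ j ∧ i ≠ r ∧ j ≠ r then
    (-1) ^ (i + j + r + 1 + theta ((r : ℤ) - (i : ℤ)) + theta ((r : ℤ) - (j : ℤ)) +
      theta ((j : ℤ) - (i : ℤ)))
  else 0

/-- `σ_{i,j,r,h,k}` for (1-based) labels. -/
def sigma5 (i j r h k : ℕ) : ℤ :=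
  if i ≠ j ∧ i ≠ r ∧ i ≠ h ∧ i ≠ k ∧ j ≠ r ∧ j ≠ h ∧ j ≠ k ∧ r ≠ h ∧ r ≠ k ∧ h ≠ k then
    (-1) ^ (h + k + 1 + theta ((k : ℤ) - (i : ℤ)) + theta ((k : ℤ) - (j : ℤ)) +
      theta ((k : ℤ) - (r : ℤ)) + theta ((k : ℤ) - (h : ℤ)) + theta ((h : ℤ) - (i : ℤ)) +
      theta ((h : ℤ) - (j : ℤ)) + theta ((h : ℤ) - (r : ℤ)))
  else 0

/-- The successor of `i` in `Fin N` (with wraparound, which is irrelevant in our uses). -/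
def finNext {N : ℕ} (i : Fin N) : Fin N :=
  ⟨(i.1 + 1) % N, Nat.mod_lt _ (Nat.lt_of_le_of_lt (Nat.zero_le _) i.2)⟩

/-- The pfaffian of an `N × N` matrix, as the sum over all partitions of `Fin N` into
two-element blocks (encoded by the permutations `σ` with `σ 0 < σ 1`, `σ 2 < σ 3`, …,
`σ 0 < σ 2 < σ 4 < ⋯`) of the sign of the permutation times the product of the entries
of `M` at the blocks.  It is `0` when `N` is odd and `1` when `N = 0`. -/
noncomputable def pfAux {R : Type*} [CommRing R] {N : ℕ} (M : Matrix (Fin N) (Fin N) R) : R :=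
  if N % 2 = 0 then
    ∑ σ ∈ Finset.univ.filter (fun σ : Equiv.Perm (Fin N) =>
        (∀ i : Fin N, (i : ℕ) % 2 = 0 → σ i < σ (finNext i)) ∧
        (∀ i j : Fin N, (i : ℕ) % 2 = 0 → (j : ℕ) % 2 = 0 → i < j → σ i < σ j)),
      ((Equiv.Perm.sign σ : ℤ) : R) *
        ∏ i ∈ Finset.univ.filter (fun i : Fin N => (i : ℕ) % 2 = 0), M (σ i) (σ (finNext i))
  else 0

/-- The pfaffian of the submatrix of `T` on the rows and columns indexed by the finset `S`
(taken in increasing order). -/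
noncomputable def pfSub {R : Type*} [CommRing R] {m : ℕ} (T : Matrix (Fin m) (Fin m) R)
    (S : Finset (Fin m)) : R :=
  pfAux (fun a b : Fin S.card => T ((S.orderIsoOfFin rfl a : Fin m)) ((S.orderIsoOfFin rfl b : Fin m)))

/-- `pfDel T l` is the pfaffian of the submatrix of `T` obtained by deleting the rows and
columns indexed by the list `l`, set to `0` if `l` has a repeated entry. -/
noncomputable def pfDel {R : Type*} [CommRing R] {m : ℕ} (T : Matrix (Fin m) (Fin m) R)
    (l : List (Fin m)) : R :=
  if l.Nodup then pfSub T (Finset.univ \ l.toFinset) else 0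

/-- `y_i := (−1)^{i+1} pf_{î}(T)` (1-based label `i + 1` for `i : Fin m`). -/
noncomputable def yPf {R : Type*} [CommRing R] {m : ℕ} (T : Matrix (Fin m) (Fin m) R)
    (i : Fin m) : R :=
  (-1 : R) ^ (((i : ℕ) + 1) + 1) * pfDel T [i]

/-- `d^k_{α,β} := Σ_i Σ_r σ_{i,k,r} c_{i,k,β} c_{r,k,α} pf_{î,k̂,r̂}(T)`, where the last
index of `c` is 0-based (`0,1,2` standing for `1,2,3`). -/
noncomputable def dTop {R : Type*} [CommRing R] {m : ℕ} (T : Matrix (Fin m) (Fin m) R)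
    (c : Fin m → Fin m → Fin 3 → R) (k : Fin m) (α β : Fin 3) : R :=
  ∑ i : Fin m, ∑ r : Fin m,
    ((sigma3 ((i : ℕ) + 1) ((k : ℕ) + 1) ((r : ℕ) + 1) : ℤ) : R) *
      c i k β * c r k α * pfDel T [i, k, r]

/-- `d^{k,i,j}_{α,β} := Σ_r σ_{i,j,r} Σ_h σ_{i,j,r,h,k} pf_{î,ĵ,r̂,ĥ,k̂}(T) c_{r,k,β} c_{h,k,α}`,
where the last index of `c` is 0-based (`0,1,2` standing for `1,2,3`). -/
noncomputable def dTop3 {R : Type*} [CommRing R] {m : ℕ} (T : Matrix (Fin m) (Fin m) R)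
    (c : Fin m → Fin m → Fin 3 → R) (k i j : Fin m) (α β : Fin 3) : R :=
  ∑ r : Fin m, ((sigma3 ((i : ℕ) + 1) ((j : ℕ) + 1) ((r : ℕ) + 1) : ℤ) : R) *
    ∑ h : Fin m,
      ((sigma5 ((i : ℕ) + 1) ((j : ℕ) + 1) ((r : ℕ) + 1) ((h : ℕ) + 1) ((k : ℕ) + 1) : ℤ) : R) *
        pfDel T [i, j, r, h, k] * c r k β * c h k α

theorem val_finNext {N : ℕ} {x : Fin N} (h : (x : ℕ) + 1 < N) : (finNext x : ℕ) = x + 1 :=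
  Nat.mod_eq_of_lt h

/-- The permutation of `Fin (n + 2)` that sends `0` to `0`, `1` to `p + 1`, and acts on the
remaining indices as `σ`. -/
def consPerm {n : ℕ} (p : Fin (n + 1)) (σ : Equiv.Perm (Fin n)) : Equiv.Perm (Fin (n + 2)) :=
  Equiv.Perm.decomposeFin.symm (0, p.cycleRange.symm * Equiv.Perm.decomposeFin.symm (0, σ))

section consPerm

variable {n : ℕ} (p : Fin (n + 1)) (σ : Equiv.Perm (Fin n))

@[simp]
theorem consPerm_zero : consPerm p σ 0 = 0 := by
  simp [consPerm]

@[simp]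
theorem consPerm_one : consPerm p σ 1 = p.succ := by
  simp [consPerm]

@[simp]
theorem consPerm_succ_succ (x : Fin n) : consPerm p σ x.succ.succ = (p.succAbove (σ x)).succ := by
  simp [consPerm]

theorem sign_consPerm : Equiv.Perm.sign (consPerm p σ) = (-1) ^ (p : ℕ) * Equiv.Perm.sign σ := by
  simp [consPerm]

theorem consPerm_injective :
    Function.Injective fun x : Fin (n + 1) × Equiv.Perm (Fin n) => consPerm x.1 x.2 := by
  rintro ⟨p, σ⟩ ⟨q, τ⟩ h
  have h1 : p = q := by simpa using congrArg (fun e : Equiv.Perm (Fin (n + 2)) => e 1) h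
  subst h1
  refine Prod.ext rfl (Equiv.ext fun x => ?_)
  simpa using congrArg (fun e : Equiv.Perm (Fin (n + 2)) => e x.succ.succ) h

theorem exists_consPerm_eq {τ : Equiv.Perm (Fin (n + 2))} (h : τ 0 = 0) :
    ∃ p σ, consPerm p σ = τ := by
  obtain ⟨⟨a, e⟩, rfl⟩ := Equiv.Perm.decomposeFin.symm.surjective τ
  obtain rfl : a = 0 := by simpa using h
  obtain ⟨⟨b, σ⟩, hb⟩ := Equiv.Perm.decomposeFin.symm.surjective ((e 0).cycleRange * e)
  obtain rfl : b = 0 := by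
    simpa using congrArg (fun e : Equiv.Perm (Fin (n + 1)) => e 0) hb
  refine ⟨e 0, σ, ?_⟩
  rw [consPerm, hb]
  congr 2
  ext x
  simp

end consPerm

/-- The permutations listing the blocks of a perfect matching of `Fin N` in standard order. -/
def IsMatchingPerm {N : ℕ} (σ : Equiv.Perm (Fin N)) : Prop :=
  (∀ i : Fin N, (i : ℕ) % 2 = 0 → σ i < σ (finNext i)) ∧
    (∀ i j : Fin N, (i : ℕ) % 2 = 0 → (j : ℕ) % 2 = 0 → i < j → σ i < σ j)

theorem val_succ_succ_mod_two {n : ℕ} (x : Fin n) : (x.succ.succ : ℕ) % 2 = x % 2 := by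
  simp only [Fin.val_succ]
  omega

theorem finNext_succ_succ {n : ℕ} (hn : n % 2 = 0) {x : Fin n} (hx : (x : ℕ) % 2 = 0) :
    finNext x.succ.succ = (finNext x).succ.succ := by
  ext
  rw [val_finNext (by simp; omega)]
  simp [val_finNext (x := x) (by omega)]

theorem finNext_zero {n : ℕ} : finNext (0 : Fin (n + 2)) = 1 := by
  ext
  rw [val_finNext (by simp)]
  simp

theorem isMatchingPerm_consPerm {n : ℕ} (hn : n % 2 = 0) (p : Fin (n + 1))
    (σ : Equiv.Perm (Fin n)) : IsMatchingPerm (consPerm p σ) ↔ IsMatchingPerm σ := by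
  have hlt (a b : Fin n) : (p.succAbove a).succ < (p.succAbove b).succ ↔ a < b := by
    rw [Fin.succ_lt_succ_iff, p.strictMono_succAbove.lt_iff_lt]
  constructor
  · rintro ⟨h1, h2⟩
    refine ⟨fun x hx => ?_, fun x y hx hy hxy => ?_⟩
    · have := h1 x.succ.succ ((val_succ_succ_mod_two x).trans hx)
      rwa [finNext_succ_succ hn hx, consPerm_succ_succ, consPerm_succ_succ, hlt] at this
    · have := h2 x.succ.succ y.succ.succ ((val_succ_succ_mod_two x).trans hx)
        ((val_succ_succ_mod_two y).trans hy) (by simpa using hxy)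
      rwa [consPerm_succ_succ, consPerm_succ_succ, hlt] at this
  · rintro ⟨h1, h2⟩
    refine ⟨fun x => ?_, fun x y => ?_⟩
    · refine Fin.cases (fun _ => ?_) (fun x => Fin.cases (fun h => ?_) (fun x hx => ?_) x) x
      · rw [finNext_zero]
        simp
      · simp at h
      · have hx' : (x : ℕ) % 2 = 0 := (val_succ_succ_mod_two x).symm.trans hx
        rw [finNext_succ_succ hn hx', consPerm_succ_succ, consPerm_succ_succ, hlt]
        exact h1 x hx'
    · refine Fin.cases (fun hx hy hxy => ?_) (fun y => Fin.cases (fun _ h => ?_) (fun y => ?_) y) y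
      · simp at hxy
      · simp at h
      · refine Fin.cases (fun hx hy hxy => ?_) (fun x => Fin.cases (fun h => ?_) (fun x => ?_) x) x
        · simp
        · simp at h
        · intro hx hy hxy
          rw [consPerm_succ_succ, consPerm_succ_succ, hlt]
          exact h2 x y ((val_succ_succ_mod_two x).symm.trans hx)
            ((val_succ_succ_mod_two y).symm.trans hy) (by simpa using hxy)

theorem IsMatchingPerm.apply_zero {n : ℕ} (hn : n % 2 = 0) {τ : Equiv.Perm (Fin (n + 2))}
    (h : IsMatchingPerm τ) : τ 0 = 0 := by
  have hle : ∀ x : Fin (n + 2), (x : ℕ) % 2 = 0 → τ 0 ≤ τ x := by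
    intro x hx
    rcases (Fin.zero_le x).eq_or_lt with h0 | h0
    · rw [h0]
    · exact (h.2 0 x rfl hx h0).le
  obtain ⟨x, hx⟩ := τ.surjective 0
  refine le_antisymm ?_ (Fin.zero_le _)
  rcases Nat.mod_two_eq_zero_or_one x with h0 | h0
  · exact hx ▸ hle x h0
  · let y : Fin (n + 2) := ⟨x - 1, by omega⟩
    have hy : (y : ℕ) % 2 = 0 := by simp only [y]; omega
    have hyx : finNext y = x := by
      ext
      rw [val_finNext (by simp only [y]; omega)]
      simp only [y]
      omega
    have := (hle y hy).trans (h.1 y hy).le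
    rwa [hyx, hx] at this

theorem pfAux_succ_succ {R : Type*} [CommRing R] {n : ℕ} (M : Matrix (Fin (n + 2)) (Fin (n + 2)) R) :
    pfAux M = ∑ p : Fin (n + 1), (-1) ^ (p : ℕ) * M 0 p.succ *
      pfAux fun a b => M (p.succAbove a).succ (p.succAbove b).succ := by
  classical
  by_cases hn : n % 2 = 0
  swap
  · simp [pfAux, hn]
  have hn2 : (n + 2) % 2 = 0 := by omega
  simp only [pfAux, if_pos hn, if_pos hn2, Finset.mul_sum]
  rw [← Finset.sum_product']
  symm
  refine Finset.sum_bij (fun x _ => consPerm x.1 x.2) ?_ ?_ ?_ ?_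
  · rintro ⟨p, σ⟩ h
    simp only [Finset.mem_product, Finset.mem_univ, true_and, Finset.mem_filter] at h ⊢
    exact (isMatchingPerm_consPerm hn p σ).2 h
  · intro x _ y _ h
    exact consPerm_injective h
  · intro τ h
    have h' : IsMatchingPerm τ := (Finset.mem_filter.1 h).2
    obtain ⟨p, σ, rfl⟩ := exists_consPerm_eq (h'.apply_zero hn)
    refine ⟨(p, σ), ?_, rfl⟩
    simp only [Finset.mem_product, Finset.mem_univ, true_and, Finset.mem_filter]
    exact (isMatchingPerm_consPerm hn p σ).1 h'
  · rintro ⟨p, σ⟩ _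
    rw [sign_consPerm, Finset.prod_filter, Finset.prod_filter, Fin.prod_univ_succ,
      Fin.prod_univ_succ]
    have hprod : ∀ x : Fin n,
        (if (x.succ.succ : ℕ) % 2 = 0 then
          M (consPerm p σ x.succ.succ) (consPerm p σ (finNext x.succ.succ)) else 1) =
        if (x : ℕ) % 2 = 0 then
          M (p.succAbove (σ x)).succ (p.succAbove (σ (finNext x))).succ else 1 := by
      intro x
      by_cases hx : (x : ℕ) % 2 = 0
      · rw [if_pos hx, if_pos ((val_succ_succ_mod_two x).trans hx), finNext_succ_succ hn hx, consPerm_succ_succ,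
          consPerm_succ_succ]
      · rw [if_neg hx, if_neg (by rwa [val_succ_succ_mod_two])]
    simp only [hprod, finNext_zero]
    simp
    ring


section AlternatingPfaffian

variable {R M : Type*} [CommRing R] [AddCommGroup M] [Module R M]

theorem contractLeft_ιMulti (d : Module.Dual R M) {n : ℕ} (f : Fin (n + 1) → M) :
    CliffordAlgebra.contractLeft d (ExteriorAlgebra.ιMulti R (n + 1) f) =
      ∑ p : Fin (n + 1), ((-1) ^ (p : ℕ) * d (f p)) • ExteriorAlgebra.ιMulti R n (p.removeNth f) := by
  induction n with
  | zero =>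
    rw [ExteriorAlgebra.ιMulti_succ_apply, ExteriorAlgebra.ιMulti_zero_apply]
    simp [ExteriorAlgebra.ι, CliffordAlgebra.contractLeft_ι, Algebra.algebraMap_eq_smul_one]
  | succ n ih =>
    rw [ExteriorAlgebra.ιMulti_succ_apply]
    have h := CliffordAlgebra.contractLeft_ι_mul d (f 0)
      (ExteriorAlgebra.ιMulti R (n + 1) (Matrix.vecTail f))
    refine h.trans ?_
    rw [ih, Finset.mul_sum, sub_eq_add_neg, ← Finset.sum_neg_distrib]
    conv_rhs => rw [Fin.sum_univ_succ]
    congr 1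
    · simp [Fin.removeNth_zero]
      rfl
    · refine Finset.sum_congr rfl fun p _ => ?_
      rw [ExteriorAlgebra.ιMulti_succ_apply (R := R) (p.succ.removeNth f), mul_smul_comm, ← neg_smul]
      have h0 : p.succ.removeNth f 0 = f 0 := by simp [Fin.removeNth]
      have h1 : Matrix.vecTail (p.succ.removeNth f) = p.removeNth (Matrix.vecTail f) := by
        ext q
        simp [Fin.removeNth, Matrix.vecTail]
      rw [h0, h1, Fin.val_succ, pow_succ]
      congr 1
      simp [Matrix.vecTail]

theorem toQuadraticMap_neg_eq_of_isAlt {B : LinearMap.BilinForm R M} (hB : B.IsAlt) :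
    (-B).toQuadraticMap = (0 : QuadraticForm R M) - 0 := by
  ext x
  simp [hB.self_eq_zero x]

/-- The pfaffian of the Gram matrix of an alternating bilinear form, as an alternating map. -/
noncomputable def altPf (B : LinearMap.BilinForm R M) (hB : B.IsAlt) (n : ℕ) : M [⋀^Fin n]→ₗ[R] R :=
  (ExteriorAlgebra.algebraMapInv.toLinearMap ∘ₗ
    CliffordAlgebra.changeForm (toQuadraticMap_neg_eq_of_isAlt hB)).compAlternatingMap
      (ExteriorAlgebra.ιMulti R n)

variable (B : LinearMap.BilinForm R M) (hB : B.IsAlt)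

theorem altPf_zero (f : Fin 0 → M) : altPf B hB 0 f = 1 := by
  have h := CliffordAlgebra.changeForm_one (toQuadraticMap_neg_eq_of_isAlt hB)
  simp only [altPf, LinearMap.compAlternatingMap_apply, ExteriorAlgebra.ιMulti_zero_apply,
    LinearMap.comp_apply]
  refine (congrArg _ h).trans ?_
  simp

theorem altPf_succ {n : ℕ} (f : Fin (n + 1) → M) :
    altPf B hB (n + 1) f = ExteriorAlgebra.algebraMapInv
      (CliffordAlgebra.changeForm (toQuadraticMap_neg_eq_of_isAlt hB)
        (CliffordAlgebra.contractLeft (B (f 0))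
          (ExteriorAlgebra.ιMulti R n (Matrix.vecTail f)))) := by
  have h := CliffordAlgebra.changeForm_ι_mul (toQuadraticMap_neg_eq_of_isAlt hB) (f 0)
    (ExteriorAlgebra.ιMulti R n (Matrix.vecTail f))
  rw [altPf, LinearMap.compAlternatingMap_apply, ExteriorAlgebra.ιMulti_succ_apply]
  refine (congrArg _ h).trans ?_
  rw [CliffordAlgebra.changeForm_contractLeft]
  have h0 (x y : ExteriorAlgebra R M) :
      ExteriorAlgebra.algebraMapInv (ExteriorAlgebra.ι R (f 0) * x + y) =
        ExteriorAlgebra.algebraMapInv y := by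
    simp [ExteriorAlgebra.algebraMapInv]
  rw [LinearMap.neg_apply, map_neg, LinearMap.neg_apply, sub_neg_eq_add]
  exact h0 _ _

theorem altPf_one (f : Fin 1 → M) : altPf B hB 1 f = 0 := by
  rw [altPf_succ, ExteriorAlgebra.ιMulti_zero_apply]
  have h := CliffordAlgebra.contractLeft_one (Q := (0 : QuadraticForm R M)) (B (f 0))
  refine (congrArg (fun x => ExteriorAlgebra.algebraMapInv
    (CliffordAlgebra.changeForm (toQuadraticMap_neg_eq_of_isAlt hB) x)) h).trans ?_
  simp

theorem altPf_cons {n : ℕ} (v : M) (f : Fin (n + 1) → M) :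
    altPf B hB (n + 2) (Fin.cons v f) =
      ∑ p : Fin (n + 1), (-1) ^ (p : ℕ) * B v (f p) * altPf B hB n (p.removeNth f) := by
  rw [altPf_succ]
  have h : Matrix.vecTail (Fin.cons v f : Fin (n + 2) → M) = f := rfl
  rw [h, Fin.cons_zero, contractLeft_ιMulti, map_sum, map_sum]
  refine Finset.sum_congr rfl fun p _ => ?_
  rw [map_smul, map_smul, smul_eq_mul]
  rfl

theorem altPf_cons_of_mem {n : ℕ} (f : Fin n → M) (p : Fin n) :
    altPf B hB (n + 1) (Fin.cons (f p) f) = 0 :=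
  (altPf B hB (n + 1)).map_eq_zero_of_eq _ (i := 0) (j := p.succ) (by simp) (Fin.succ_ne_zero p).symm

theorem altPf_cons_removeNth {n : ℕ} (f : Fin (n + 1) → M) (p : Fin (n + 1)) :
    altPf B hB (n + 1) (Fin.cons (f p) (p.removeNth f)) =
      (-1) ^ (p : ℕ) * altPf B hB (n + 1) f := by
  rw [Fin.cons_removeNth_eq_comp_cycleRange_symm, AlternatingMap.map_perm]
  simp [Units.smul_def]

end AlternatingPfaffian

section RowExpansion

variable {R : Type*} [CommRing R] {m : ℕ} (T : Matrix (Fin m) (Fin m) R)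

theorem isAlt_toBilin' (hskew : ∀ a b, T b a = -T a b) (hdiag : ∀ a, T a a = 0) :
    (Matrix.toBilin' T).IsAlt := by
  intro v
  rw [Matrix.toBilin'_apply, ← Finset.sum_product']
  refine Finset.sum_involution (fun x _ => x.swap) ?_ ?_ ?_ ?_
  · rintro ⟨a, b⟩ _
    rw [Prod.fst_swap, Prod.snd_swap, hskew a b]
    ring
  · rintro ⟨a, b⟩ _ h hab
    obtain rfl : b = a := congrArg Prod.fst hab
    simp [hdiag] at h
  · simp
  · simp

theorem pfAux_eq_altPf (hB : (Matrix.toBilin' T).IsAlt) :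
    ∀ (n : ℕ) (f : Fin n → Fin m), pfAux (fun a b => T (f a) (f b)) =
      altPf (Matrix.toBilin' T) hB n fun a => Pi.single (f a) 1
  | 0, f => by
    rw [altPf_zero]
    simp [pfAux]
  | 1, f => by
    rw [altPf_one]
    simp [pfAux]
  | n + 2, f => by
    refine (pfAux_succ_succ _).trans ?_
    have h : (fun a => Pi.single (f a) 1 : Fin (n + 2) → Fin m → R) =
        Fin.cons (Pi.single (f 0) 1) fun a : Fin (n + 1) => Pi.single (f a.succ) 1 := by
      rw [← Fin.cons_self_tail (fun a => Pi.single (f a) 1 : Fin (n + 2) → Fin m → R)]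
      rfl
    rw [h, altPf_cons]
    refine Finset.sum_congr rfl fun p _ => ?_
    rw [pfAux_eq_altPf hB n fun a => f (p.succAbove a).succ, Matrix.toBilin'_single]
    rfl

theorem card_filter_lt_univ {n : ℕ} (p : Fin n) :
    ((Finset.univ : Finset (Fin n)).filter (· < p)).card = p := by
  rw [← Fin.card_Iio p]
  congr 1
  ext x
  simp

theorem pfSub_image {n : ℕ} {g : Fin n → Fin m} (hg : StrictMono g) :
    pfSub T (Finset.univ.image g) = pfAux fun a b => T (g a) (g b) := by
  have hcard : (Finset.univ.image g).card = n := by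
    rw [Finset.card_image_of_injective _ hg.injective, Finset.card_univ, Fintype.card_fin]
  generalize hS : Finset.univ.image g = S at hcard
  subst hcard
  have h : g = S.orderEmbOfFin rfl :=
    Finset.orderEmbOfFin_unique rfl (fun x => hS ▸ Finset.mem_image_of_mem g (Finset.mem_univ x)) hg
  simp only [pfSub, Finset.coe_orderIsoOfFin_apply, ← h]

theorem card_filter_lt_image {n : ℕ} {g : Fin n → Fin m} (hg : StrictMono g) (p : Fin n) :
    ((Finset.univ.image g).filter (· < g p)).card = p := by
  rw [Finset.filter_image, Finset.card_image_of_injective _ hg.injective]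
  simp only [hg.lt_iff_lt]
  exact card_filter_lt_univ p

theorem exists_strictMono_image_eq {n : ℕ} {S : Finset (Fin m)} (hS : S.card = n) :
    ∃ g : Fin n → Fin m, StrictMono g ∧ Finset.univ.image g = S :=
  ⟨S.orderEmbOfFin hS, (S.orderEmbOfFin hS).strictMono, S.image_orderEmbOfFin_univ hS⟩

theorem erase_image_eq_image_succAbove {n : ℕ} {g : Fin (n + 1) → Fin m} (hg : StrictMono g)
    (p : Fin (n + 1)) :
    (Finset.univ.image g).erase (g p) = Finset.univ.image (g ∘ p.succAbove) := by
  rw [← Finset.image_image, Fin.image_succAbove_univ, ← Finset.image_erase hg.injective,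
    ← Finset.compl_singleton, Finset.compl_eq_univ_sdiff, Finset.sdiff_singleton_eq_erase]

/-- The Laplace-type sum along row `j` of `T` over the columns in `S`. -/
noncomputable def rowSum (j : Fin m) (S : Finset (Fin m)) : R :=
  ∑ r ∈ S, (-1) ^ (S.filter (· < r)).card * T j r * pfSub T (S.erase r)

theorem rowSum_image (hB : (Matrix.toBilin' T).IsAlt) (j : Fin m) {n : ℕ} {g : Fin n → Fin m}
    (hg : StrictMono g) : rowSum T j (Finset.univ.image g) =
      altPf (Matrix.toBilin' T) hB (n + 1)
        (Fin.cons (Pi.single j 1) fun a => Pi.single (g a) 1) := by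
  cases n with
  | zero => simp [rowSum, altPf_one]
  | succ n =>
    rw [rowSum, Finset.sum_image hg.injective.injOn, altPf_cons]
    refine Finset.sum_congr rfl fun p _ => ?_
    rw [card_filter_lt_image hg, erase_image_eq_image_succAbove hg,
      pfSub_image T (hg.comp p.strictMono_succAbove), pfAux_eq_altPf T hB, Matrix.toBilin'_single]
    rfl

theorem rowSum_of_mem (hB : (Matrix.toBilin' T).IsAlt) {j : Fin m} {S : Finset (Fin m)}
    (hj : j ∈ S) : rowSum T j S = 0 := by
  obtain ⟨n, hn⟩ : ∃ n, S.card = n := ⟨_, rfl⟩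
  obtain ⟨g, hg, rfl⟩ := exists_strictMono_image_eq hn
  obtain ⟨p, -, rfl⟩ := Finset.mem_image.1 hj
  rw [rowSum_image T hB _ hg]
  exact altPf_cons_of_mem _ hB (fun a => (Pi.single (g a) 1 : Fin m → R)) p

theorem rowSum_of_notMem (hB : (Matrix.toBilin' T).IsAlt) {j : Fin m} {S : Finset (Fin m)}
    (hj : j ∉ S) :
    rowSum T j S = (-1) ^ (S.filter (· < j)).card * pfSub T (insert j S) := by
  obtain ⟨g, hg, hS⟩ := exists_strictMono_image_eq (Finset.card_insert_of_notMem hj)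
  obtain ⟨p, -, rfl⟩ := Finset.mem_image.1 (hS ▸ Finset.mem_insert_self j S)
  have hcard : (S.filter (· < g p)).card = p := by
    rw [← card_filter_lt_image hg p, hS, Finset.filter_insert, if_neg (lt_irrefl _)]
  have herase : S = Finset.univ.image (g ∘ p.succAbove) := by
    rw [← erase_image_eq_image_succAbove hg, hS, Finset.erase_insert hj]
  rw [hcard, ← hS, pfSub_image T hg, pfAux_eq_altPf T hB, ← altPf_cons_removeNth]
  conv_lhs => rw [herase]
  exact rowSum_image T hB _ (hg.comp p.strictMono_succAbove)

end RowExpansion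

section Signs

variable {m : ℕ}

/-- The indicator of `a < b`. -/
def ltIndicator (a b : Fin m) : ℕ := if a < b then 1 else 0

theorem theta_succ_sub_succ (a b : Fin m) :
    theta ((((b : ℕ) + 1 : ℕ) : ℤ) - (((a : ℕ) + 1 : ℕ) : ℤ)) = ltIndicator a b := by
  have h : (0 : ℤ) < (((b : ℕ) + 1 : ℕ) : ℤ) - (((a : ℕ) + 1 : ℕ) : ℤ) ↔ a < b := by
    rw [Fin.lt_def]
    omega
  simp only [theta, ltIndicator, h]

theorem ltIndicator_add_swap {a b : Fin m} (h : a ≠ b) : ltIndicator a b + ltIndicator b a = 1 := by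
  rcases h.lt_or_gt with h | h <;> simp [ltIndicator, h, h.not_gt]

theorem ltIndicator_self (a : Fin m) : ltIndicator a a = 0 := by
  simp [ltIndicator]

theorem card_filter_lt_compl (A : Finset (Fin m)) (j : Fin m) :
    ((Finset.univ \ A).filter (· < j)).card + ∑ a ∈ A, ltIndicator a j = j := by
  have h : ∑ a ∈ A, ltIndicator a j = (A.filter (· < j)).card := by
    simp only [ltIndicator, Finset.card_filter]
  rw [h, ← Finset.card_union_of_disjoint, ← Finset.filter_union,
    Finset.sdiff_union_of_subset (Finset.subset_univ A), card_filter_lt_univ]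
  exact Finset.disjoint_filter_filter Finset.sdiff_disjoint

theorem card_filter_lt_compl_four {a b c d : Fin m} (hab : a ≠ b) (hac : a ≠ c) (had : a ≠ d)
    (hbc : b ≠ c) (hbd : b ≠ d) (hcd : c ≠ d) (j : Fin m) :
    ((Finset.univ \ {a, b, c, d}).filter (· < j)).card +
      (ltIndicator a j + (ltIndicator b j + (ltIndicator c j + ltIndicator d j))) = j := by
  rw [← card_filter_lt_compl {a, b, c, d} j, Finset.sum_insert (by simp [hab, hac, had]),
    Finset.sum_insert (by simp [hbc, hbd]), Finset.sum_insert (by simp [hcd]), Finset.sum_singleton]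

theorem sigma3_of_distinct {i j r : Fin m} (hij : i ≠ j) (hir : i ≠ r) (hjr : j ≠ r) :
    sigma3 ((i : ℕ) + 1) ((j : ℕ) + 1) ((r : ℕ) + 1) =
      (-1) ^ ((i : ℕ) + j + r + ltIndicator i r + ltIndicator j r + ltIndicator i j) := by
  rw [sigma3, if_pos (by simp [Fin.val_inj, hij, hir, hjr])]
  simp only [theta_succ_sub_succ]
  exact neg_one_pow_congr (by simp only [Nat.even_iff]; omega)

theorem sigma5_of_distinct {i j r h k : Fin m} (hij : i ≠ j) (hir : i ≠ r) (hih : i ≠ h)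
    (hik : i ≠ k) (hjr : j ≠ r) (hjh : j ≠ h) (hjk : j ≠ k) (hrh : r ≠ h) (hrk : r ≠ k)
    (hhk : h ≠ k) :
    sigma5 ((i : ℕ) + 1) ((j : ℕ) + 1) ((r : ℕ) + 1) ((h : ℕ) + 1) ((k : ℕ) + 1) =
      (-1) ^ ((h : ℕ) + k + 1 + ltIndicator i k + ltIndicator j k + ltIndicator r k +
        ltIndicator h k + ltIndicator i h + ltIndicator j h + ltIndicator r h) := by
  rw [sigma5, if_pos (by simp [Fin.val_inj, hij, hir, hih, hik, hjr, hjh, hjk, hrh, hrk, hhk])]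
  simp only [theta_succ_sub_succ]
  exact neg_one_pow_congr (by simp only [Nat.even_iff]; omega)

theorem sigma5_eq_zero {i j r h k : Fin m}
    (H : i = j ∨ i = r ∨ i = h ∨ i = k ∨ j = r ∨ j = h ∨ j = k ∨ r = h ∨ r = k ∨ h = k) :
    sigma5 ((i : ℕ) + 1) ((j : ℕ) + 1) ((r : ℕ) + 1) ((h : ℕ) + 1) ((k : ℕ) + 1) = 0 := by
  rw [sigma5, if_neg]
  rintro ⟨h1, h2, h3, h4, h5, h6, h7, h8, h9, h10⟩
  rcases H with rfl | rfl | rfl | rfl | rfl | rfl | rfl | rfl | rfl | rfl <;> contradiction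

/-- The sign left over from `σ_{i,r,s} σ_{i,r,s,h,k}` after removing the dependence on `r`. -/
def sigma4 (i s h k : Fin m) : ℤ :=
  if i ≠ s ∧ i ≠ h ∧ i ≠ k ∧ s ≠ h ∧ s ≠ k ∧ h ≠ k then
    (-1) ^ ((i : ℕ) + s + h + k + ltIndicator i s + ltIndicator i k + ltIndicator s k +
      ltIndicator h k + ltIndicator i h + ltIndicator s h)
  else 0

end Signs

section Deletion

theorem neg_neg_one_pow_mul {R : Type*} [CommRing R] (n : ℕ) (x : R) :
    -((-1) ^ n * x) = (-1) ^ (n + 1) * x := by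
  ring

variable {R : Type*} [CommRing R] {m : ℕ} (T : Matrix (Fin m) (Fin m) R)

/-- The signed pfaffian `σ_{a,b,c} pf_{â,b̂,ĉ}(T)`. -/
noncomputable def signedPf (a b c : Fin m) : R :=
  ((sigma3 ((a : ℕ) + 1) ((b : ℕ) + 1) ((c : ℕ) + 1) : ℤ) : R) * pfDel T [a, b, c]

theorem signedPf_of_distinct {a b c : Fin m} (hab : a ≠ b) (hac : a ≠ c) (hbc : b ≠ c) :
    signedPf T a b c =
      (-1) ^ ((a : ℕ) + b + c + ltIndicator a c + ltIndicator b c + ltIndicator a b) *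
        pfSub T (Finset.univ \ {a, b, c}) := by
  rw [signedPf, sigma3_of_distinct hab hac hbc, pfDel, if_pos (by simp [hab, hac, hbc])]
  simp

theorem signedPf_eq_zero {a b c : Fin m} (h : a = b ∨ a = c ∨ b = c) : signedPf T a b c = 0 := by
  rw [signedPf, pfDel, if_neg, mul_zero]
  rcases h with rfl | rfl | rfl <;> simp

theorem signedPf_swap_left (a b c : Fin m) : signedPf T b a c = -signedPf T a b c := by
  by_cases hab : a = b
  · rw [signedPf_eq_zero T (.inl hab), signedPf_eq_zero T (.inl hab.symm), neg_zero]
  by_cases hac : a = c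
  · rw [signedPf_eq_zero T (.inr (.inl hac)), signedPf_eq_zero T (.inr (.inr hac)), neg_zero]
  by_cases hbc : b = c
  · rw [signedPf_eq_zero T (.inr (.inl hbc)), signedPf_eq_zero T (.inr (.inr hbc)), neg_zero]
  rw [signedPf_of_distinct T hab hac hbc, signedPf_of_distinct T (Ne.symm hab) hbc hac,
    Finset.insert_comm b a, neg_neg_one_pow_mul]
  congr 1
  have := ltIndicator_add_swap hab
  exact neg_one_pow_congr (by simp only [Nat.even_iff]; omega)

theorem signedPf_swap_right (a b c : Fin m) : signedPf T a c b = -signedPf T a b c := by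
  by_cases hab : a = b
  · rw [signedPf_eq_zero T (.inl hab), signedPf_eq_zero T (.inr (.inl hab)), neg_zero]
  by_cases hac : a = c
  · rw [signedPf_eq_zero T (.inr (.inl hac)), signedPf_eq_zero T (.inl hac), neg_zero]
  by_cases hbc : b = c
  · rw [signedPf_eq_zero T (.inr (.inr hbc)), signedPf_eq_zero T (.inr (.inr hbc.symm)), neg_zero]
  rw [signedPf_of_distinct T hab hac hbc, signedPf_of_distinct T hac hab (Ne.symm hbc),
    Finset.pair_comm c b, neg_neg_one_pow_mul]
  congr 1
  have := ltIndicator_add_swap hbc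
  exact neg_one_pow_congr (by simp only [Nat.even_iff]; omega)

theorem mul_sigma3_mul_sigma5_mul_pfDel (hskew : ∀ a b, T b a = -T a b) (i r s h k j : Fin m) :
    T r j * (((sigma3 ((i : ℕ) + 1) ((r : ℕ) + 1) ((s : ℕ) + 1) : ℤ) : R) *
      (((sigma5 ((i : ℕ) + 1) ((r : ℕ) + 1) ((s : ℕ) + 1) ((h : ℕ) + 1) ((k : ℕ) + 1) : ℤ) : R) *
        pfDel T [i, r, s, h, k])) =
    if r ∈ Finset.univ \ {i, s, h, k} then
      -((sigma4 i s h k : ℤ) : R) * ((-1) ^ ((Finset.univ \ {i, s, h, k}).filter (· < r)).card *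
        T j r * pfSub T ((Finset.univ \ {i, s, h, k}).erase r))
    else 0 := by
  split_ifs with hr
  · simp only [Finset.mem_sdiff, Finset.mem_univ, true_and, Finset.mem_insert,
      Finset.mem_singleton, not_or] at hr
    obtain ⟨hri, hrs, hrh, hrk⟩ := hr
    by_cases H : i ≠ s ∧ i ≠ h ∧ i ≠ k ∧ s ≠ h ∧ s ≠ k ∧ h ≠ k
    · obtain ⟨his, hih, hik, hsh, hsk, hhk⟩ := H
      have hset : Finset.univ \ [i, r, s, h, k].toFinset =
          (Finset.univ \ {i, s, h, k}).erase r := by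
        ext x
        simp
        tauto
      rw [sigma3_of_distinct (Ne.symm hri) his hrs,
        sigma5_of_distinct (Ne.symm hri) his hih hik hrs hrh hrk hsh hsk hhk, sigma4,
        if_pos ⟨his, hih, hik, hsh, hsk, hhk⟩, pfDel,
        if_pos (by simp [his, hih, hik, hsh, hsk, hhk, hrs, hrh, hrk, Ne.symm hri]),
        hset, hskew j r]
      have hsign : ∀ a b c d : ℕ, (Even (a + b) ↔ Even (c + d)) → ∀ x y : R,
          -x * ((((-1) ^ a : ℤ) : R) * ((((-1) ^ b : ℤ) : R) * y)) =
            -(((-1) ^ c : ℤ) : R) * ((-1) ^ d * x * y) := by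
        intro a b c d habcd x y
        have := neg_one_pow_congr (R := R) habcd
        rw [pow_add, pow_add] at this
        push_cast
        linear_combination -(x * y) * this
      apply hsign
      have h1 := card_filter_lt_compl_four his hih hik hsh hsk hhk r
      have h2 := ltIndicator_add_swap hrs
      have h3 := ltIndicator_add_swap hrh
      have h4 := ltIndicator_add_swap hrk
      simp only [Nat.even_iff]
      omega
    · rw [sigma4, if_neg H, sigma5_eq_zero]
      · simp
      · tauto
  · rw [sigma5_eq_zero]
    · simp
    · simp only [Finset.mem_sdiff, Finset.mem_univ, true_and, Finset.mem_insert,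
        Finset.mem_singleton, not_not] at hr
      rcases hr with rfl | rfl | rfl | rfl <;> simp

theorem sum_mul_dTop3 (hskew : ∀ a b, T b a = -T a b) (c : Fin m → Fin m → Fin 3 → R)
    (i j k : Fin m) (α β : Fin 3) :
    ∑ r ∈ Finset.univ.filter (fun r : Fin m => r ≠ k), T r j * dTop3 T c k i r α β =
      -∑ s, ∑ h, ((sigma4 i s h k : ℤ) : R) * rowSum T j (Finset.univ \ {i, s, h, k}) *
        c s k β * c h k α := by
  have hk : ∀ r, T r j * dTop3 T c k i r α β = ∑ s, ∑ h,
      (if r ∈ Finset.univ \ {i, s, h, k} then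
        -((sigma4 i s h k : ℤ) : R) * ((-1) ^ ((Finset.univ \ {i, s, h, k}).filter (· < r)).card *
          T j r * pfSub T ((Finset.univ \ {i, s, h, k}).erase r)) else 0) * c s k β * c h k α := by
    intro r
    simp only [dTop3, Finset.mul_sum, ← mul_sigma3_mul_sigma5_mul_pfDel T hskew]
    refine Finset.sum_congr rfl fun s _ => Finset.sum_congr rfl fun h _ => ?_
    ring
  rw [Finset.sum_filter_of_ne]
  · simp only [hk]
    rw [Finset.sum_comm, ← Finset.sum_neg_distrib]
    refine Finset.sum_congr rfl fun s _ => ?_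
    rw [Finset.sum_comm, ← Finset.sum_neg_distrib]
    refine Finset.sum_congr rfl fun h _ => ?_
    rw [← Finset.sum_mul, ← Finset.sum_mul, Finset.sum_ite_mem, Finset.univ_inter,
      ← Finset.mul_sum, rowSum]
    ring
  · rintro r - hr rfl
    refine hr ?_
    rw [hk]
    simp

theorem sigma4_mul_rowSum (hB : (Matrix.toBilin' T).IsAlt) {i j k : Fin m} (hki : k ≠ i)
    (hkj : k ≠ j) (s h : Fin m) :
    ((sigma4 i s h k : ℤ) : R) * rowSum T j (Finset.univ \ {i, s, h, k}) =
      (if i = j then signedPf T s k h else 0) + (if s = j then signedPf T k i h else 0) -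
        (if h = j then signedPf T k i s else 0) := by
  have hcyc : signedPf T s k i = signedPf T k i s := by
    rw [signedPf_swap_left T k s i, signedPf_swap_right T k i s, neg_neg]
  by_cases H : i ≠ s ∧ i ≠ h ∧ i ≠ k ∧ s ≠ h ∧ s ≠ k ∧ h ≠ k
  swap
  · rw [sigma4, if_neg H, Int.cast_zero, zero_mul]
    have H' : i = s ∨ i = h ∨ s = h ∨ s = k ∨ h = k := by tauto
    rcases H' with rfl | rfl | rfl | rfl | rfl
    · rw [signedPf_eq_zero T (a := k) (b := i) (c := i) (by simp), signedPf_swap_left T k i h]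
      split_ifs <;> ring
    · rw [signedPf_eq_zero T (a := k) (b := i) (c := i) (by simp), hcyc]
      split_ifs <;> ring
    · rw [signedPf_eq_zero T (a := s) (b := k) (c := s) (by simp)]
      split_ifs <;> ring
    · rw [signedPf_eq_zero T (a := s) (b := s) (c := h) (by simp),
        signedPf_eq_zero T (a := s) (b := i) (c := s) (by simp), if_neg hkj]
      simp
    · rw [signedPf_eq_zero T (a := s) (b := h) (c := h) (by simp),
        signedPf_eq_zero T (a := h) (b := i) (c := h) (by simp), if_neg hkj]
      simp
  obtain ⟨his, hih, hik, hsh, hsk, hhk⟩ := H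
  rw [sigma4, if_pos ⟨his, hih, hik, hsh, hsk, hhk⟩]
  have hcard := card_filter_lt_compl_four his hih hik hsh hsk hhk j
  have h1 := ltIndicator_add_swap his
  have h2 := ltIndicator_add_swap hih
  have h3 := ltIndicator_add_swap hik
  have h4 := ltIndicator_add_swap hsh
  have h5 := ltIndicator_add_swap hsk
  have h6 := ltIndicator_add_swap hhk
  have hself := ltIndicator_self j
  by_cases hj : j ∈ Finset.univ \ {i, s, h, k}
  · simp only [Finset.mem_sdiff, Finset.mem_univ, true_and, Finset.mem_insert,
      Finset.mem_singleton, not_or] at hj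
    rw [rowSum_of_mem T hB (by simpa using hj), if_neg (Ne.symm hj.1), if_neg (Ne.symm hj.2.1),
      if_neg (Ne.symm hj.2.2.1)]
    simp
  rw [rowSum_of_notMem T hB hj, ← mul_assoc]
  push_cast
  rw [← pow_add]
  have hj' : j = i ∨ j = s ∨ j = h := by
    simp only [Finset.mem_sdiff, Finset.mem_univ, true_and, Finset.mem_insert,
      Finset.mem_singleton, not_not] at hj
    have := Ne.symm hkj
    tauto
  rcases hj' with rfl | rfl | rfl
  · have hset : insert j (Finset.univ \ {j, s, h, k}) = Finset.univ \ {s, k, h} := by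
      ext x
      have : x = j → x ≠ s ∧ x ≠ k ∧ x ≠ h := by rintro rfl; exact ⟨his, hik, hih⟩
      simp
      tauto
    rw [if_pos rfl, if_neg (Ne.symm his), if_neg (Ne.symm hih), add_zero, sub_zero, hset,
      signedPf_of_distinct T hsk hsh (Ne.symm hhk)]
    congr 1
    exact neg_one_pow_congr (by simp only [Nat.even_iff]; omega)
  · have hset : insert j (Finset.univ \ {i, j, h, k}) = Finset.univ \ {k, i, h} := by
      ext x
      have : x = j → x ≠ i ∧ x ≠ k ∧ x ≠ h := by rintro rfl; exact ⟨Ne.symm his, hsk, hsh⟩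
      simp
      tauto
    rw [if_pos rfl, if_neg his, if_neg (Ne.symm hsh), zero_add, sub_zero, hset,
      signedPf_of_distinct T hki (Ne.symm hhk) hih]
    congr 1
    exact neg_one_pow_congr (by simp only [Nat.even_iff]; omega)
  · have hset : insert j (Finset.univ \ {i, s, j, k}) = Finset.univ \ {k, i, s} := by
      ext x
      have : x = j → x ≠ i ∧ x ≠ k ∧ x ≠ s := by
        rintro rfl; exact ⟨Ne.symm hih, hhk, Ne.symm hsh⟩
      simp
      tauto
    rw [if_pos rfl, if_neg hih, if_neg hsh, zero_add, zero_sub, hset,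
      signedPf_of_distinct T hki (Ne.symm hsk) his, neg_neg_one_pow_mul]
    congr 1
    exact neg_one_pow_congr (by simp only [Nat.even_iff]; omega)

end Deletion

/-- The vanishing of the coefficient of `v₁₂ᵏ` in the verification of the products `F₁′·F₂` on
the resolution of the trimmed ideal: with `T_{j,i} = Σ_l c_{i,j,l} z_l` (subscripts of `z` and
the last index of `c` encoded 0-based by `Fin 3`), for `i, j, k` with `k ∉ {i,j}`
(`i = j` allowed):
`δ_{i,j}·d^k_{1,2} + Σ_{r≠k} T_{r,j} d^{k,i,r}_{1,2}
  + Σ_r σ_{k,i,r} pf_{k̂,î,r̂}(T)·(c_{r,k,1} c_{j,k,2} − c_{j,k,1} c_{r,k,2}) = 0`. -/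
theorem trimming_res_productE_coeff {R : Type*} [CommRing R] (m : ℕ) (hodd : Odd m)
    (hpos : 0 < m) (T : Matrix (Fin m) (Fin m) R)
    (hskew : ∀ a b, T b a = - T a b) (hdiag : ∀ a, T a a = 0)
    (z : Fin 3 → R) (c : Fin m → Fin m → Fin 3 → R)
    (hc : ∀ i j : Fin m, T j i = ∑ l : Fin 3, c i j l * z l)
    (i j k : Fin m) (hki : k ≠ i) (hkj : k ≠ j) :
    (if i = j then (1 : R) else 0) * dTop T c k 0 1
      + ∑ r ∈ Finset.univ.filter (fun r : Fin m => r ≠ k), T r j * dTop3 T c k i r 0 1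
      + ∑ r : Fin m, ((sigma3 ((k : ℕ) + 1) ((i : ℕ) + 1) ((r : ℕ) + 1) : ℤ) : R) *
          pfDel T [k, i, r] * (c r k 0 * c j k 1 - c j k 0 * c r k 1) = 0 := by
  have hB := isAlt_toBilin' T hskew hdiag
  have hterm : ∀ r : Fin m, ((sigma3 ((k : ℕ) + 1) ((i : ℕ) + 1) ((r : ℕ) + 1) : ℤ) : R) *
      pfDel T [k, i, r] = signedPf T k i r := fun r => rfl
  have hd : dTop T c k 0 1 = ∑ s, ∑ h, signedPf T s k h * c s k 1 * c h k 0 := by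
    simp only [dTop, signedPf]
    refine Finset.sum_congr rfl fun s _ => Finset.sum_congr rfl fun h _ => ?_
    ring
  rw [sum_mul_dTop3 T hskew, hd]
  simp only [hterm, sigma4_mul_rowSum T hB hki hkj, add_mul, sub_mul, mul_sub,
    Finset.sum_add_distrib, Finset.sum_sub_distrib, ite_mul, zero_mul, one_mul]
  have h1 : ∑ s, ∑ h, (if s = j then signedPf T k i h * c s k 1 * c h k 0 else 0) =
      ∑ r, signedPf T k i r * (c r k 0 * c j k 1) := by
    rw [Finset.sum_comm]
    refine Finset.sum_congr rfl fun h _ => ?_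
    rw [Finset.sum_ite_eq', if_pos (Finset.mem_univ j)]
    ring
  have h2 : ∑ s, ∑ h, (if h = j then signedPf T k i s * c s k 1 * c h k 0 else 0) =
      ∑ r, signedPf T k i r * (c j k 0 * c r k 1) := by
    refine Finset.sum_congr rfl fun s _ => ?_
    rw [Finset.sum_ite_eq', if_pos (Finset.mem_univ j)]
    ring
  rw [h1, h2]
  by_cases hij : i = j
  · simp only [if_pos hij]
    ring
  · simp only [if_neg hij, Finset.sum_const_zero]
    ring
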